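/- Let k ≥ 2 be an integer, α ∈ ℝ and β ∈ ℝ∖ℤ. Then there exists a function F, holomorphic on ℂ∖(−∞, 0], such that F(x) = ∫₀^∞ Li_{k−1}(e^{−xt} e^{2πiα}) / (1 − e^{−t} e^{2πiβ}) dt for every x ∈ ℂ with Re(x) > 0. (Concretely, F(x) = Σ_{p=1}^∞ e^{2πiαp} p^{1−k} ψ_β(px), where ψ_β(y) := lim_{N→∞} Σ_{q=0}^{N} e^{2πiβq}/(y+q).) -/

import Mathlib

open Complex MeasureTheory Filter Topology Set Asymptotics

noncomputable section

/-- `e2pi θ = e^{2πiθ}`. -/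
def e2pi (θ : ℝ) : ℂ := Complex.exp (2 * Real.pi * Complex.I * θ)

/-- Polylogarithm of integer order: `Li 0 z = z/(1-z)`, `Li 1 z = -Log(1-z)`,
`Li m z = ∑_{n≥1} z^n/n^m` for `m ≥ 2`. -/
def Li : ℕ → ℂ → ℂ
  | 0, z => z / (1 - z)
  | 1, z => -Complex.log (1 - z)
  | (m+2), z => ∑' n : ℕ, z ^ (n+1) / ((n+1 : ℕ) : ℂ) ^ (m+2)

/-- `ψ_β(x) = ∑_{q≥0} e^{2πiβq}/(x+q)`, summed as the limit of its partial sums. -/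
def psiBeta (β : ℝ) (x : ℂ) : ℂ :=
  limUnder atTop (fun N : ℕ => ∑ q ∈ Finset.range (N + 1), e2pi (β * q) / (x + q))


lemma norm_e2pi (θ : ℝ) : ‖e2pi θ‖ = 1 := by
  unfold e2pi
  rw [Complex.norm_exp]
  simp

lemma e2pi_nat_mul (n : ℕ) (θ : ℝ) : e2pi (n * θ) = e2pi θ ^ n := by
  unfold e2pi
  rw [← Complex.exp_nat_mul]
  congr 1
  push_cast
  ring

lemma e2pi_ne_one (β : ℝ) (hβ : ∀ n : ℤ, β ≠ n) : e2pi β ≠ 1 := by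
  unfold e2pi
  intro h
  rw [Complex.exp_eq_one_iff] at h
  obtain ⟨n, hn⟩ := h
  apply hβ n
  have h2 : (2 * Real.pi * Complex.I : ℂ) ≠ 0 := Complex.two_pi_I_ne_zero
  have : (β : ℂ) = n := by
    apply mul_left_cancel₀ h2
    rw [hn]; ring
  exact_mod_cast this

lemma den_bound (c : ℂ) (hc : ‖c‖ = 1) (hc1 : c ≠ 1) :
    ∃ M : ℝ, 0 < M ∧ ∀ t : ℝ, 0 ≤ t → M ≤ ‖1 - Complex.exp (-(t : ℂ)) * c‖ := by
  obtain ⟨r, hr, hmin⟩ := (isCompact_Icc (a := (0:ℝ)) (b := 1)).exists_isMinOn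
    (f := fun r : ℝ => ‖1 - (r : ℂ) * c‖) ⟨0, by simp⟩ (by fun_prop)
  refine ⟨‖1 - (r : ℂ) * c‖, ?_, ?_⟩
  · rw [norm_pos_iff]
    intro h
    have h1 : (r : ℂ) * c = 1 := (sub_eq_zero.mp h).symm
    have h2 : ‖(r : ℂ) * c‖ = 1 := by rw [h1]; simp
    rw [norm_mul, hc, mul_one, Complex.norm_real, Real.norm_of_nonneg hr.1] at h2
    rw [h2] at h1
    simp at h1
    exact hc1 h1
  · intro t ht
    have := hmin (show Real.exp (-t) ∈ Set.Icc (0:ℝ) 1 from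
      ⟨(Real.exp_pos _).le, by simpa using ht⟩)
    simpa using this

def Jk (c y : ℂ) (t : ℝ) : ℂ := Complex.exp (-y * t) / (1 - Complex.exp (-(t : ℂ)) * c)

lemma Jk_bound (c y : ℂ) (M : ℝ) (hM : 0 < M)
    (hb : ∀ t : ℝ, 0 ≤ t → M ≤ ‖1 - Complex.exp (-(t : ℂ)) * c‖) (hy : 0 < y.re) :
    IntegrableOn (Jk c y) (Set.Ioi 0) ∧ ∫ t in Set.Ioi (0:ℝ), ‖Jk c y t‖ ≤ 1 / (M * y.re) := by
  have hle : ∀ t ∈ Set.Ioi (0:ℝ), ‖Jk c y t‖ ≤ Real.exp (-y.re * t) / M := by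
    intro t ht
    unfold Jk
    rw [norm_div, Complex.norm_exp]
    have : (-y * (t : ℂ)).re = -y.re * t := by simp
    rw [this]
    exact div_le_div_of_nonneg_left (Real.exp_pos _).le hM (hb t (le_of_lt ht))
  have hi : IntegrableOn (fun t : ℝ => Real.exp (-y.re * t) / M) (Set.Ioi 0) :=
    (integrableOn_exp_mul_Ioi (by linarith) 0).div_const M
  have hI : IntegrableOn (Jk c y) (Set.Ioi 0) := by
    refine Integrable.mono' hi ?_ ?_
    · apply Measurable.aestronglyMeasurable
      unfold Jk
      fun_prop
    · exact (ae_restrict_iff' measurableSet_Ioi).2 (Eventually.of_forall hle)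
  refine ⟨hI, ?_⟩
  calc ∫ t in Set.Ioi (0:ℝ), ‖Jk c y t‖ ≤ ∫ t in Set.Ioi (0:ℝ), Real.exp (-y.re * t) / M :=
        setIntegral_mono_on hI.norm hi measurableSet_Ioi hle
    _ = 1 / (M * y.re) := by
        rw [integral_div, integral_exp_mul_Ioi (by linarith)]
        simp
        field_simp

lemma J_rec (c y : ℂ) (M : ℝ) (hM : 0 < M)
    (hb : ∀ t : ℝ, 0 ≤ t → M ≤ ‖1 - Complex.exp (-(t : ℂ)) * c‖) (hy : 0 < y.re) :
    ∫ t in Set.Ioi (0:ℝ), Jk c y t = 1 / y + c * ∫ t in Set.Ioi (0:ℝ), Jk c (y + 1) t := by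
  have hy' : 0 < (y + 1).re := by simp; linarith
  have h1 := (Jk_bound c (y+1) M hM hb hy').1
  have h2 : IntegrableOn (fun t : ℝ => Complex.exp (-y * t)) (Set.Ioi 0) :=
    integrableOn_exp_mul_complex_Ioi (by simpa using hy) 0
  have h3 : ∫ t in Set.Ioi (0:ℝ), Complex.exp (-y * t) = 1 / y := by
    rw [integral_exp_mul_complex_Ioi (by simpa using hy)]
    simp
  rw [← h3, ← integral_const_mul, ← integral_add h2 (h1.const_mul c)]
  apply setIntegral_congr_fun measurableSet_Ioi
  intro t ht
  have hne : 1 - Complex.exp (-(t : ℂ)) * c ≠ 0 := by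
    rw [← norm_pos_iff]
    exact lt_of_lt_of_le hM (hb t (le_of_lt ht))
  have he : Complex.exp (-(y + 1) * t) = Complex.exp (-y * t) * Complex.exp (-(t : ℂ)) := by
    rw [← Complex.exp_add]; congr 1; ring
  simp only [Jk]
  rw [he]
  field_simp
  ring

lemma J_iter (c y : ℂ) (M : ℝ) (hM : 0 < M)
    (hb : ∀ t : ℝ, 0 ≤ t → M ≤ ‖1 - Complex.exp (-(t : ℂ)) * c‖) (hy : 0 < y.re) (N : ℕ) :
    ∫ t in Set.Ioi (0:ℝ), Jk c y t =
      ∑ q ∈ Finset.range N, c ^ q / (y + q) + c ^ N * ∫ t in Set.Ioi (0:ℝ), Jk c (y + N) t := by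
  induction N with
  | zero => simp
  | succ N ih =>
    have hyN : 0 < (y + N).re := by
      have : (0:ℝ) ≤ N := Nat.cast_nonneg N
      simp; linarith
    rw [ih, J_rec c (y + N) M hM hb hyN, Finset.sum_range_succ]
    push_cast
    rw [← add_assoc y]
    ring

lemma psi_eq_int (β : ℝ) (hβ : ∀ n : ℤ, β ≠ n) (y : ℂ) (hy : 0 < y.re) :
    psiBeta β y = ∫ t in Set.Ioi (0:ℝ), Jk (e2pi β) y t := by
  obtain ⟨M, hM, hb⟩ := den_bound _ (norm_e2pi β) (e2pi_ne_one β hβ)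
  unfold psiBeta
  apply Tendsto.limUnder_eq
  have hrem : Tendsto (fun N : ℕ => e2pi β ^ (N+1) * ∫ t in Set.Ioi (0:ℝ),
      Jk (e2pi β) (y + (N+1 : ℕ)) t) atTop (𝓝 0) := by
    have hlim : Tendsto (fun N : ℕ => (1 / M) * (1 / ((N : ℝ) + 1))) atTop (𝓝 0) := by
      simpa using (tendsto_one_div_add_atTop_nhds_zero_nat (𝕜 := ℝ)).const_mul (1 / M)
    refine squeeze_zero_norm (fun N => ?_) hlim
    have hN : (0:ℝ) ≤ N := Nat.cast_nonneg N
    have hre : (y + (N+1 : ℕ)).re = y.re + (N + 1) := by simp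
    have hp : 0 < (y + (N+1 : ℕ)).re := by rw [hre]; linarith
    rw [norm_mul, norm_pow, norm_e2pi, one_pow, one_mul]
    refine (norm_integral_le_integral_norm _).trans
      ((Jk_bound _ _ M hM hb hp).2.trans ?_)
    rw [hre, one_div_mul_one_div]
    apply one_div_le_one_div_of_le (by positivity)
    exact mul_le_mul_of_nonneg_left (by linarith) hM.le
  have h := (tendsto_const_nhds (x := ∫ t in Set.Ioi (0:ℝ), Jk (e2pi β) y t)).sub hrem
  rw [sub_zero] at h
  refine h.congr (fun N => ?_)
  rw [J_iter (e2pi β) y M hM hb hy (N+1), add_sub_cancel_right]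
  apply Finset.sum_congr rfl
  intro q _
  rw [mul_comm β, e2pi_nat_mul]

lemma Li_hasSum (m : ℕ) (z : ℂ) (hz : ‖z‖ < 1) :
    HasSum (fun n : ℕ => z ^ (n+1) / ((n+1 : ℕ) : ℂ) ^ (m+1)) (Li (m+1) z) := by
  cases m with
  | zero =>
    have h := Complex.hasSum_taylorSeries_neg_log hz
    rw [← hasSum_nat_add_iff' 1] at h
    simpa [Li] using h
  | succ m =>
    apply Summable.hasSum
    have hg : Summable (fun n : ℕ => ‖z‖ ^ (n+1)) :=
      (summable_nat_add_iff 1).2 (summable_geometric_of_lt_one (norm_nonneg _) hz)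
    refine Summable.of_norm_bounded hg (fun n => ?_)
    rw [norm_div, norm_pow, norm_pow, Complex.norm_natCast]
    apply div_le_self (by positivity)
    apply one_le_pow₀
    push_cast
    have : (0:ℝ) ≤ n := Nat.cast_nonneg n
    linarith

lemma tele (P : ℝ) (hP : 0 < P) :
    HasSum (fun q : ℕ => 1 / ((P + q) * (P + q + 1))) (1 / P) := by
  rw [hasSum_iff_tendsto_nat_of_nonneg (fun i => by positivity)]
  have h : ∀ n : ℕ, ∑ i ∈ Finset.range n, 1 / ((P + i) * (P + i + 1)) = 1 / P - 1 / (P + n) := by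
    intro n
    have := Finset.sum_range_sub' (fun i : ℕ => 1 / (P + i)) n
    simp only [Nat.cast_zero, add_zero] at this
    rw [← this]
    apply Finset.sum_congr rfl
    intro i _
    have : (0:ℝ) ≤ i := Nat.cast_nonneg i
    have h1 : P + i ≠ 0 := by positivity
    have h2 : P + i + 1 ≠ 0 := by positivity
    have h3 : P + (i + 1) ≠ 0 := by positivity
    push_cast
    field_simp
    ring
  simp_rw [h]
  have h0 : Tendsto (fun n : ℕ => 1 / (P + n)) atTop (𝓝 0) := by
    simp_rw [one_div]
    exact tendsto_inv_atTop_zero.comp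
      (tendsto_atTop_add_const_left _ _ tendsto_natCast_atTop_atTop)
  simpa using tendsto_const_nhds.sub h0

lemma parts (c y : ℂ) (hy : ∀ q : ℕ, y + q ≠ 0) (N : ℕ) :
    (1 - c) * ∑ q ∈ Finset.range (N + 1), c ^ q / (y + q) =
      1 / y - c ^ (N+1) / (y + N) -
        ∑ q ∈ Finset.range N, c ^ (q+1) / ((y + q) * (y + q + 1)) := by
  induction N with
  | zero =>
    have := hy 0
    simp at this
    simp
    field_simp
  | succ N ih =>
    rw [Finset.sum_range_succ, mul_add, ih, Finset.sum_range_succ _ N]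
    have h1 := hy N
    have h2 := hy (N+1)
    push_cast at h2 ⊢
    have h3 : y + N + 1 ≠ 0 := by rwa [add_assoc]
    rw [← add_assoc] at *
    field_simp
    ring

lemma T_bound (c y : ℂ) (hc : ‖c‖ = 1) (δ P : ℝ) (hδ : 0 < δ) (hP : 0 < P)
    (h : ∀ q : ℕ, δ * (P + q) ≤ ‖y + q‖) (q : ℕ) :
    ‖c ^ (q+1) / ((y + q) * (y + q + 1))‖ ≤ (δ^2)⁻¹ * (1 / ((P + q) * (P + q + 1))) := by
  have h1 := h q
  have h2 := h (q+1)
  push_cast at h2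
  rw [← add_assoc, ← add_assoc] at h2
  rw [norm_div, norm_pow, hc, one_pow, norm_mul]
  rw [inv_eq_one_div, one_div_mul_one_div]
  apply one_div_le_one_div_of_le (by positivity)
  calc δ^2 * ((P + q) * (P + q + 1)) = (δ * (P + q)) * (δ * (P + q + 1)) := by ring
    _ ≤ _ := by gcongr

lemma psi_formula (β : ℝ) (hβ : ∀ n : ℤ, β ≠ n) (y : ℂ) (δ P : ℝ) (hδ : 0 < δ) (hP : 0 < P)
    (h : ∀ q : ℕ, δ * (P + q) ≤ ‖y + q‖) :
    psiBeta β y = (1 - e2pi β)⁻¹ *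
      (1 / y - ∑' q : ℕ, e2pi β ^ (q+1) / ((y + q) * (y + q + 1))) := by
  have hc := norm_e2pi β
  have hc1 := e2pi_ne_one β hβ
  have hs : Summable (fun q : ℕ => e2pi β ^ (q+1) / ((y + q) * (y + q + 1))) :=
    Summable.of_norm_bounded ((tele P hP).summable.mul_left _)
      (T_bound (e2pi β) y hc δ P hδ hP h)
  have hy : ∀ q : ℕ, y + q ≠ 0 := by
    intro q
    rw [← norm_pos_iff]
    exact lt_of_lt_of_le (by positivity) (h q)
  have hne : 1 - e2pi β ≠ 0 := sub_ne_zero.2 (Ne.symm hc1)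
  unfold psiBeta
  apply Tendsto.limUnder_eq
  have h0 : Tendsto (fun N : ℕ => e2pi β ^ (N+1) / (y + N)) atTop (𝓝 0) := by
    have hlim : Tendsto (fun N : ℕ => δ⁻¹ * (1 / (P + N))) atTop (𝓝 0) := by
      have : Tendsto (fun n : ℕ => 1 / (P + n)) atTop (𝓝 0) := by
        simp_rw [one_div]
        exact tendsto_inv_atTop_zero.comp
          (tendsto_atTop_add_const_left _ _ tendsto_natCast_atTop_atTop)
      simpa using this.const_mul δ⁻¹
    refine squeeze_zero_norm (fun N => ?_) hlim
    rw [norm_div, norm_pow, hc, one_pow, inv_eq_one_div, one_div_mul_one_div]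
    exact one_div_le_one_div_of_le (by positivity) (h N)
  have hT := (((tendsto_const_nhds (x := 1 / y)).sub h0).sub
    hs.hasSum.tendsto_sum_nat).const_mul (1 - e2pi β)⁻¹
  rw [sub_zero] at hT
  refine hT.congr (fun N => ?_)
  rw [← parts (e2pi β) y hy N, inv_mul_cancel_left₀ hne]
  apply Finset.sum_congr rfl
  intro q _
  rw [mul_comm β, e2pi_nat_mul]

lemma psi_norm (β : ℝ) (hβ : ∀ n : ℤ, β ≠ n) (y : ℂ) (δ P : ℝ) (hδ : 0 < δ) (hP : 0 < P)
    (h : ∀ q : ℕ, δ * (P + q) ≤ ‖y + q‖) :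
    ‖psiBeta β y‖ ≤ ‖(1 - e2pi β)⁻¹‖ * (δ⁻¹ + (δ^2)⁻¹) * (1 / P) := by
  rw [psi_formula β hβ y δ P hδ hP h, norm_mul, mul_assoc]
  gcongr
  refine (norm_sub_le _ _).trans ?_
  rw [add_mul]
  apply add_le_add
  · have := h 0
    simp only [Nat.cast_zero, add_zero] at this
    rw [norm_div, norm_one, inv_eq_one_div, one_div_mul_one_div]
    exact one_div_le_one_div_of_le (by positivity) this
  · exact tsum_of_norm_bounded ((tele P hP).mul_left _)
      (T_bound (e2pi β) y (norm_e2pi β) δ P hδ hP h)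

lemma slit_bound (K : Set ℂ) (hK : IsCompact K) (hne : K.Nonempty) (hs : K ⊆ Complex.slitPlane) :
    ∃ δ : ℝ, 0 < δ ∧ ∀ x ∈ K, ∀ p q : ℝ, 0 < p → 0 ≤ q → δ * (p + q) ≤ ‖(p : ℂ) * x + q‖ := by
  obtain ⟨⟨s, x⟩, hsx, hmin⟩ := ((isCompact_Icc (a := (0:ℝ)) (b := 1)).prod hK).exists_isMinOn
    (f := fun r : ℝ × ℂ => ‖(r.1 : ℂ) * r.2 + (1 - r.1 : ℝ)‖)
    (⟨0, by simp⟩ |> fun h : (Set.Icc (0:ℝ) 1).Nonempty => h.prod hne) (by fun_prop)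
  refine ⟨‖(s : ℂ) * x + (1 - s : ℝ)‖, ?_, ?_⟩
  · rw [norm_pos_iff]
    have hx : x ∈ Complex.slitPlane := hs hsx.2
    have := Complex.starConvex_one_slitPlane hx (a := 1 - s) (b := s)
      (by linarith [hsx.1.2]) hsx.1.1 (by ring)
    have h0 := Complex.slitPlane_ne_zero this
    convert h0 using 1
    simp
    ring
  · intro x' hx' p q hp hq
    have hpq : 0 < p + q := by linarith
    have h := hmin (show (p / (p + q), x') ∈ Set.Icc (0:ℝ) 1 ×ˢ K from
      ⟨⟨by positivity, by rw [div_le_one hpq]; linarith⟩, hx'⟩)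
    simp only [Set.mem_ofPred_eq] at h
    have hc : ((p : ℂ) + q) ≠ 0 := by exact_mod_cast hpq.ne'
    have e : (p : ℂ) * x' + q = ((p + q : ℝ) : ℂ) *
        (((p / (p + q) : ℝ) : ℂ) * x' + ((1 - p / (p + q) : ℝ) : ℂ)) := by
      push_cast
      field_simp
      ring
    rw [e, norm_mul, Complex.norm_real, Real.norm_of_nonneg hpq.le, mul_comm]
    gcongr

lemma psi_diff (β : ℝ) (hβ : ∀ n : ℤ, β ≠ n) (U : Set ℂ) (hU : IsOpen U) (δ P : ℝ)
    (hδ : 0 < δ) (hP : 0 < P) (h : ∀ x ∈ U, ∀ q : ℕ, δ * (P + q) ≤ ‖(P : ℂ) * x + q‖) :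
    DifferentiableOn ℂ (fun x => psiBeta β ((P : ℂ) * x)) U := by
  have hne : ∀ x ∈ U, ∀ q : ℕ, (P : ℂ) * x + q ≠ 0 := by
    intro x hx q
    rw [← norm_pos_iff]
    exact lt_of_lt_of_le (by positivity) (h x hx q)
  refine DifferentiableOn.congr ?_ (fun x hx => psi_formula β hβ _ δ P hδ hP (h x hx))
  apply DifferentiableOn.const_mul
  apply DifferentiableOn.sub
  · apply DifferentiableOn.div (by fun_prop) (by fun_prop)
    intro x hx
    simpa using hne x hx 0
  · refine Complex.differentiableOn_tsum_of_summable_norm ((tele P hP).summable.mul_left (δ^2)⁻¹)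
      (fun q => ?_) hU (fun q x hx =>
        T_bound (e2pi β) _ (norm_e2pi β) δ P hδ hP (h x hx) q)
    apply DifferentiableOn.div (by fun_prop) (by fun_prop)
    intro x hx
    apply mul_ne_zero (hne x hx q)
    have := hne x hx (q+1)
    push_cast at this
    rwa [add_assoc]

lemma coef_norm (α : ℝ) (m p : ℕ) :
    ‖e2pi ((p + 1) * α) * ((p + 1 : ℕ) : ℂ) ^ ((1 : ℤ) - (m + 2 : ℕ))‖ ≤ 1 / ((p : ℝ) + 1) := by
  rw [norm_mul, norm_e2pi, one_mul, norm_zpow, Complex.norm_natCast]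
  have : (1 : ℤ) - (m + 2 : ℕ) = -((m + 1 : ℕ) : ℤ) := by push_cast; ring
  rw [this, zpow_neg, zpow_natCast, ← one_div]
  apply one_div_le_one_div_of_le (by positivity)
  push_cast
  exact le_self_pow₀ (by linarith [(Nat.cast_nonneg p : (0:ℝ) ≤ p)]) (by omega)

lemma sum_sq : Summable (fun p : ℕ => (1 / ((p : ℝ) + 1)) * (1 / ((p : ℝ) + 1))) := by
  have := (summable_nat_add_iff 1).2 (Real.summable_one_div_nat_pow (p := 2) |>.2 (by norm_num))
  refine this.congr (fun p => ?_)
  push_cast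
  field_simp

/-- Analytic continuation of the higher Herglotz–Zagier–Novikov function `𝓕_k(x; α, β)` to the
cut plane `ℂ∖(-∞,0]`: there is a holomorphic function on the slit plane agreeing with the
defining integral on `{Re x > 0}`; concretely it is given by
`∑_{p≥1} e^{2πiαp} p^{1-k} ψ_β(px)`. -/
theorem HHZN_analytic_continuation (k : ℕ) (hk : 2 ≤ k) (α β : ℝ) (hβ : ∀ n : ℤ, β ≠ n) :
    ∃ F : ℂ → ℂ, DifferentiableOn ℂ F Complex.slitPlane ∧
      (∀ x : ℂ, 0 < x.re →
        F x = ∫ t in Set.Ioi (0:ℝ),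
          Li (k - 1) (Complex.exp (-x * t) * e2pi α) /
            (1 - Complex.exp (-(t : ℂ)) * e2pi β)) ∧
      (∀ x ∈ Complex.slitPlane,
        F x = ∑' p : ℕ,
          e2pi ((p + 1) * α) * ((p + 1 : ℕ) : ℂ) ^ ((1 : ℤ) - k) * psiBeta β ((p + 1) * x)) := by
  obtain ⟨m, rfl⟩ : ∃ m, k = m + 2 := ⟨k - 2, by omega⟩
  refine ⟨fun x => ∑' p : ℕ, e2pi ((p + 1) * α) * ((p + 1 : ℕ) : ℂ) ^ ((1 : ℤ) - (m + 2 : ℕ)) *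
    psiBeta β ((p + 1) * x), ?_, ?_, fun x _ => rfl⟩
  · intro x0 hx0
    obtain ⟨r, hr, hball⟩ := Metric.nhds_basis_closedBall.mem_iff.1
      (Complex.isOpen_slitPlane.mem_nhds hx0)
    obtain ⟨δ, hδ, hbd⟩ := slit_bound _ (isCompact_closedBall x0 r)
      ⟨x0, Metric.mem_closedBall_self hr.le⟩ hball
    have hbd' : ∀ p : ℕ, ∀ x ∈ Metric.ball x0 r, ∀ q : ℕ,
        δ * (((p : ℝ) + 1) + q) ≤ ‖(((p : ℝ) + 1 : ℝ) : ℂ) * x + q‖ := by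
      intro p x hx q
      have := hbd x (Metric.ball_subset_closedBall hx) ((p : ℝ) + 1) q (by positivity)
        (by positivity)
      simpa using this
    have hd : DifferentiableOn ℂ (fun x => ∑' p : ℕ, e2pi ((p + 1) * α) *
        ((p + 1 : ℕ) : ℂ) ^ ((1 : ℤ) - (m + 2 : ℕ)) * psiBeta β ((p + 1) * x))
        (Metric.ball x0 r) := by
      refine Complex.differentiableOn_tsum_of_summable_norm
        (sum_sq.mul_left (‖(1 - e2pi β)⁻¹‖ * (δ⁻¹ + (δ^2)⁻¹))) (fun p => ?_) Metric.isOpen_ball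
        (fun p x hx => ?_)
      · apply DifferentiableOn.const_mul
        have := psi_diff β hβ _ Metric.isOpen_ball δ ((p : ℝ) + 1) hδ (by positivity) (hbd' p)
        simpa using this
      · have := psi_norm β hβ _ δ ((p : ℝ) + 1) hδ (by positivity) (hbd' p x hx)
        rw [norm_mul]
        have h2 := coef_norm α m p
        push_cast at this h2 ⊢
        calc _ ≤ (1 / ((p : ℝ) + 1)) * (‖(1 - e2pi β)⁻¹‖ * (δ⁻¹ + (δ^2)⁻¹) *
              (1 / ((p : ℝ) + 1))) := by gcongr
          _ = _ := by ring
    exact (hd.differentiableAt (Metric.ball_mem_nhds x0 hr)).differentiableWithinAt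
  · intro x hx
    obtain ⟨M, hM, hb⟩ := den_bound _ (norm_e2pi β) (e2pi_ne_one β hβ)
    have hpx : ∀ p : ℕ, (((p : ℂ) + 1) * x).re = ((p : ℝ) + 1) * x.re := by
      intro p
      simp
    have hpx0 : ∀ p : ℕ, 0 < (((p : ℂ) + 1) * x).re := by
      intro p
      rw [hpx]; positivity
    have hS := hasSum_integral_of_summable_integral_norm (μ := volume.restrict (Set.Ioi (0:ℝ)))
      (F := fun (p : ℕ) (t : ℝ) => e2pi ((p + 1) * α) *
        ((p + 1 : ℕ) : ℂ) ^ ((1 : ℤ) - (m + 2 : ℕ)) * Jk (e2pi β) ((p + 1) * x) t)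
      (fun p => ((Jk_bound _ _ M hM hb (hpx0 p)).1).const_mul _) (by
        refine Summable.of_nonneg_of_le (fun p => integral_nonneg (fun t => norm_nonneg _))
          (fun p => ?_) (sum_sq.mul_left (1 / (M * x.re)))
        simp_rw [norm_mul _ (Jk _ _ _)]
        rw [integral_const_mul]
        have h1 := (Jk_bound _ _ M hM hb (hpx0 p)).2
        rw [hpx] at h1
        calc _ ≤ (1 / ((p : ℝ) + 1)) * (1 / (M * (((p : ℝ) + 1) * x.re))) :=
              mul_le_mul (coef_norm α m p) h1 (integral_nonneg (fun t => norm_nonneg _))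
                (by positivity)
          _ = _ := by field_simp)
    have e1 : ∀ p : ℕ, ∫ t in Set.Ioi (0:ℝ), e2pi ((p + 1) * α) *
        ((p + 1 : ℕ) : ℂ) ^ ((1 : ℤ) - (m + 2 : ℕ)) * Jk (e2pi β) ((p + 1) * x) t =
        e2pi ((p + 1) * α) * ((p + 1 : ℕ) : ℂ) ^ ((1 : ℤ) - (m + 2 : ℕ)) *
          psiBeta β ((p + 1) * x) := by
      intro p
      rw [integral_const_mul, psi_eq_int β hβ _ (hpx0 p)]
    simp_rw [e1] at hS
    refine hS.tsum_eq.trans ?_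
    apply setIntegral_congr_fun measurableSet_Ioi
    intro t ht
    have ht0 : 0 < t := ht
    have hz : ‖Complex.exp (-x * t) * e2pi α‖ < 1 := by
      rw [norm_mul, norm_e2pi, mul_one, Complex.norm_exp, Real.exp_lt_one_iff]
      have : (-x * (t : ℂ)).re = -(x.re * t) := by simp
      rw [this]
      have : 0 < x.re * t := by positivity
      linarith
    have hL := (Li_hasSum m _ hz).div_const (1 - Complex.exp (-(t : ℂ)) * e2pi β)
    show _ = Li (m + 1) _ / _
    rw [← hL.tsum_eq]
    apply tsum_congr
    intro p
    have he : e2pi ((p + 1) * α) = e2pi α ^ (p + 1) := by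
      rw [← e2pi_nat_mul]; push_cast; rfl
    have hk1 : (1 : ℤ) - (m + 2 : ℕ) = -((m + 1 : ℕ) : ℤ) := by push_cast; ring
    have hexp : Complex.exp (-((p + 1) * x) * t) = Complex.exp (-x * t) ^ (p + 1) := by
      rw [← Complex.exp_nat_mul]; congr 1; push_cast; ring
    rw [he, hk1, zpow_neg, zpow_natCast, Jk, hexp, mul_pow]
    ring

end
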